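/- arXiv:2105.13989 — 3 statements merged into one kernel-verified Lean document; each statement's English description precedes it below -/
import Mathlib

section
/- Let R be a commutative ring and x ∈ R. For every natural number n, the trace of the n-th power of the matrix !![2x, −1; 1, 0] equals twice the value at x of the n-th Chebyshev polynomial of the first kind: Tr(!![2x, −1; 1, 0]^n) = 2·(Polynomial.Chebyshev.T R n).eval x. -/
theorem trace_pow_eq_two_mul_chebyshevT (R : Type*) [CommRing R] (x : R) (n : ℕ) :
    (!![2 * x, -1; 1, 0] ^ n).trace = 2 * (Polynomial.Chebyshev.T R n).eval x := by
  induction n using Nat.twoStepInduction with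
  | zero => simp
  | one => simp [Matrix.trace_fin_two]
  | more n h0 h1 =>
    have hM : (!![2 * x, -1; 1, 0] : Matrix (Fin 2) (Fin 2) R) ^ 2
        = (2 * x) • !![2 * x, -1; 1, 0] - 1 := by
      rw [pow_two]
      ext i j
      fin_cases i <;> fin_cases j <;> simp [Matrix.mul_apply, Fin.sum_univ_two] <;> ring
    have hp : (!![2 * x, -1; 1, 0] : Matrix (Fin 2) (Fin 2) R) ^ (n + 2)
        = (2 * x) • !![2 * x, -1; 1, 0] ^ (n + 1) - !![2 * x, -1; 1, 0] ^ n := by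
      rw [pow_add, hM, mul_sub, mul_one, Matrix.mul_smul, ← pow_succ]
    have hT := congrArg (Polynomial.eval x) (Polynomial.Chebyshev.T_add_two R (n : ℤ))
    simp only [Polynomial.eval_sub, Polynomial.eval_mul, Polynomial.eval_X,
      Polynomial.eval_ofNat] at hT
    rw [hp, Matrix.trace_sub, Matrix.trace_smul, h0, h1, smul_eq_mul]
    push_cast
    rw [hT]
    ring
end

section
/- Let R be a commutative ring, let M be a 2×2 matrix over R with det(M) = 1, and let x ∈ R be such that Tr(M) = 2x. Then for every natural number n, Tr(M^n) = 2·(Polynomial.Chebyshev.T R n).eval x. -/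
theorem trace_pow_eq_two_mul_chebyshevT_of_det_one (R : Type*) [CommRing R]
    (M : Matrix (Fin 2) (Fin 2) R) (hdet : M.det = 1) (x : R) (htr : M.trace = 2 * x) (n : ℕ) :
    (M ^ n).trace = 2 * (Polynomial.Chebyshev.T R n).eval x := by
  have hM : M ^ 2 = (2 * x) • M - 1 := by
    rw [Matrix.det_fin_two] at hdet
    rw [Matrix.trace_fin_two] at htr
    rw [← htr, pow_two]
    ext i j
    fin_cases i <;> fin_cases j <;>
      simp [Matrix.mul_apply, Fin.sum_univ_two] <;> first | ring1 | linear_combination (-1 : R) * hdet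
  induction n using Nat.twoStepInduction with
  | zero => simp [Matrix.trace_one]
  | one => simpa using htr
  | more n ih1 ih2 =>
    have h : M ^ (n + 2) = (2 * x) • M ^ (n + 1) - M ^ n := by
      rw [pow_add, hM, mul_sub, mul_smul_comm, ← pow_succ, mul_one]
    rw [h, Matrix.trace_sub, Matrix.trace_smul, ih1, ih2]
    push_cast
    rw [Polynomial.Chebyshev.T_add_two]
    simp
    ring
end

section
/- Let R be a commutative ring and a, b, c ∈ R. Let φ be the R-algebra endomorphism of the polynomial ring R[X₀, X₁] (multivariate polynomials in two variables) determined by φ(X₀) = a·X₀ and φ(X₁) = c·X₀ + b·X₁. Then for every natural number n, the sum over k = 0, …, n of the coefficient of the monomial X₀^{n−k}·X₁^{k} in φ(X₀^{n−k}·X₁^{k}) equals Σ_{i=0}^{n} a^{n−i}·b^{i}. (This computes the trace of the n-th symmetric tensor power of the lower-triangular matrix !![a, 0; c, b].) -/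
open MvPolynomial in
theorem coeff_lin_pow_aux (R : Type*) [CommRing R] (b c : R) (k : ℕ) :
    MvPolynomial.coeff (Finsupp.single (1 : Fin 2) k)
      ((C c * X 0 + C b * X 1 : MvPolynomial (Fin 2) R) ^ k) = b ^ k := by
  induction k with
  | zero => simp
  | succ k ih =>
    have e : (C c * X 0 + C b * X 1 : MvPolynomial (Fin 2) R) ^ (k + 1)
        = C c * ((C c * X 0 + C b * X 1) ^ k * X 0)
          + C b * ((C c * X 0 + C b * X 1) ^ k * X 1) := by ring
    rw [e, coeff_add, coeff_C_mul, coeff_C_mul, coeff_mul_X', Finsupp.single_add, coeff_mul_X, ih,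
      if_neg (by simp [Finsupp.mem_support_iff])]
    ring

open MvPolynomial in
theorem trace_symm_pow_lower_triangular (R : Type*) [CommRing R] (a b c : R) (n : ℕ) :
    ∑ k ∈ Finset.range (n + 1),
      MvPolynomial.coeff (Finsupp.single 0 (n - k) + Finsupp.single 1 k)
        (MvPolynomial.bind₁
          (![MvPolynomial.C a * MvPolynomial.X 0,
             MvPolynomial.C c * MvPolynomial.X 0 + MvPolynomial.C b * MvPolynomial.X 1] :
            Fin 2 → MvPolynomial (Fin 2) R)
          (MvPolynomial.X 0 ^ (n - k) * MvPolynomial.X 1 ^ k)) =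
    ∑ i ∈ Finset.range (n + 1), a ^ (n - i) * b ^ i := by
  refine Finset.sum_congr rfl fun k _ => ?_
  have e : (C a * X 0 : MvPolynomial (Fin 2) R) ^ (n - k)
      = monomial (Finsupp.single 0 (n - k)) (a ^ (n - k)) := by
    rw [mul_pow, ← C_pow, X_pow_eq_monomial, C_mul_monomial, mul_one]
  rw [map_mul, map_pow, map_pow, bind₁_X_right, bind₁_X_right]
  simp only [Matrix.cons_val_zero, Matrix.cons_val_one]
  rw [e, coeff_monomial_mul, coeff_lin_pow_aux]
end
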